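/- For every integer T ≥ 1, the primal LP admits an optimal solution (μ₀*, μ*, μ̂*, ν*, a*) (i.e. the supremum p^T is attained) such that μ* = λ_{S^T} for some Borel set S^T satisfying X^T ⊆ S^T ⊆ cl(X^∞) and vol S^T = p^T. -/

import Mathlib

open MeasureTheory
open scoped ENNReal

/-- Feasibility for the primal LP: `μ₀ ∈ M₊(X⁰)`, `μ, μ̂, ν ∈ M₊(X)`, `a ≥ 0`,
`ν(ℝ^n) + a = T·vol X`, `μ + ν = f_# ν + μ₀`, and `μ + μ̂ = λ_X`. -/
def PrimalFeasible (n : ℕ) (f : (Fin n → ℝ) → (Fin n → ℝ))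
    (X0 X : Set (Fin n → ℝ)) (T : ℕ)
    (μ₀ μ μh ν : Measure (Fin n → ℝ)) (a : ℝ≥0∞) : Prop :=
  IsFiniteMeasure μ₀ ∧ IsFiniteMeasure μ ∧ IsFiniteMeasure μh ∧ IsFiniteMeasure ν ∧
  μ₀ X0ᶜ = 0 ∧ μ Xᶜ = 0 ∧ μh Xᶜ = 0 ∧ ν Xᶜ = 0 ∧
  ν Set.univ + a = (T : ℝ≥0∞) * volume X ∧
  μ + ν = Measure.map f ν + μ₀ ∧
  μ + μh = volume.restrict X

/-- Optimal value of the primal LP: supremum of the mass of `μ` over feasible points. -/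
noncomputable def primalValue (n : ℕ) (f : (Fin n → ℝ) → (Fin n → ℝ))
    (X0 X : Set (Fin n → ℝ)) (T : ℕ) : ℝ≥0∞ :=
  sSup {m : ℝ≥0∞ | ∃ μ₀ μ μh ν a, PrimalFeasible n f X0 X T μ₀ μ μh ν a ∧
    m = μ Set.univ}

/-- A continuous map on the Cantor set admits a Borel right inverse on its range. -/
lemma exists_measurable_section_cantorSet {F : Type*} [TopologicalSpace F] [T2Space F]
    [MeasurableSpace F] [BorelSpace F] {G : cantorSet → F} (hG : Continuous G) :
    ∃ s : F → cantorSet, Measurable s ∧ ∀ y ∈ Set.range G, G (s y) = y := by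
  have : CompactSpace cantorSet := isCompact_iff_compactSpace.mp isCompact_cantorSet
  set A : F → Set ℝ := fun y => (↑) '' (G ⁻¹' {y}) with hA
  have hcompact : ∀ y, IsCompact (A y) := fun y =>
    ((isClosed_singleton.preimage hG).isCompact).image continuous_subtype_val
  have hnonempty : ∀ y ∈ Set.range G, (A y).Nonempty := by
    rintro _ ⟨c, rfl⟩
    exact ⟨c, c, rfl, rfl⟩
  have hempty : ∀ y, y ∉ Set.range G → sInf (A y) = 0 := by
    intro y hy
    have : A y = ∅ := by
      rw [hA, Set.image_eq_empty, Set.eq_empty_iff_forall_notMem]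
      exact fun c hc => hy ⟨c, hc⟩
    rw [this, Real.sInf_empty]
  have hmem : ∀ y, sInf (A y) ∈ cantorSet := by
    intro y
    by_cases hy : y ∈ Set.range G
    · obtain ⟨c, -, hc⟩ := (hcompact y).sInf_mem (hnonempty y hy)
      exact hc ▸ c.2
    · rw [hempty y hy]
      exact zero_mem_cantorSet
  refine ⟨fun y => ⟨sInf (A y), hmem y⟩, Measurable.subtype_mk ?_, ?_⟩
  · refine measurable_of_Iic fun r => ?_
    have hset : (fun y => sInf (A y)) ⁻¹' Set.Iic r =
        G '' {c | (c : ℝ) ≤ r} ∪ ((Set.range G)ᶜ ∩ {_y | 0 ≤ r}) := by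
      ext y
      simp only [Set.mem_preimage, Set.mem_Iic, Set.mem_union, Set.mem_inter_iff,
        Set.mem_compl_iff, Set.mem_ofPred_eq]
      constructor
      · intro h
        by_cases hy : y ∈ Set.range G
        · obtain ⟨c, hc, hc'⟩ := (hcompact y).sInf_mem (hnonempty y hy)
          exact Or.inl ⟨c, by simpa only [Set.mem_ofPred_eq, hc'] using h, hc⟩
        · exact Or.inr ⟨hy, by rwa [hempty y hy] at h⟩
      · rintro (⟨c, hc, rfl⟩ | ⟨hy, hr⟩)
        · exact (csInf_le (hcompact _).bddBelow ⟨c, rfl, rfl⟩).trans hc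
        · rwa [hempty y hy]
    rw [hset]
    refine MeasurableSet.union ?_ ((isCompact_range hG).measurableSet.compl.inter (.const _))
    exact ((isClosed_le continuous_subtype_val continuous_const).isCompact.image hG).measurableSet
  · intro y hy
    obtain ⟨c, hc, hc'⟩ := (hcompact y).sInf_mem (hnonempty y hy)
    have : (⟨sInf (A y), hmem y⟩ : cantorSet) = c := Subtype.ext hc'.symm
    exact (congrArg G this).trans hc

/-- A continuous map on a compact set admits a Borel right inverse on the image of that set. -/
lemma IsCompact.exists_measurable_section {E F : Type*} [MetricSpace E] [MeasurableSpace E]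
    [BorelSpace E] [TopologicalSpace F] [T2Space F] [MeasurableSpace F] [BorelSpace F]
    {K : Set E} (hK : IsCompact K) (hne : K.Nonempty) {g : E → F} (hg : Continuous g) :
    ∃ s : F → E, Measurable s ∧ ∀ y ∈ g '' K, s y ∈ K ∧ g (s y) = y := by
  have : CompactSpace K := isCompact_iff_compactSpace.mp hK
  have : Nonempty K := hne.to_subtype
  obtain ⟨h, hcont, hsurj⟩ := exists_nat_bool_continuous_surjective_of_compact K
  have hp : Continuous fun c : cantorSet => (h (cantorSetHomeomorphNatToBool c) : E) :=
    continuous_subtype_val.comp (hcont.comp cantorSetHomeomorphNatToBool.continuous)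
  obtain ⟨s, hs, hsec⟩ := exists_measurable_section_cantorSet (hg.comp hp)
  refine ⟨_, hp.measurable.comp hs, ?_⟩
  rintro _ ⟨x, hx, rfl⟩
  refine ⟨Subtype.coe_prop _, hsec _ ?_⟩
  obtain ⟨b, hb⟩ := hsurj ⟨x, hx⟩
  exact ⟨cantorSetHomeomorphNatToBool.symm b, by simp [hb]⟩

/-- A measure carried by the image of a compact set lifts to a measure carried by that set. -/
lemma IsCompact.exists_map_eq {E F : Type*} [MetricSpace E] [MeasurableSpace E]
    [BorelSpace E] [TopologicalSpace F] [T2Space F] [MeasurableSpace F] [BorelSpace F]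
    {K : Set E} (hK : IsCompact K) {g : E → F} (hg : Continuous g)
    {σ : Measure F} (hσ : σ (g '' K)ᶜ = 0) :
    ∃ m : Measure E, m Kᶜ = 0 ∧ m.map g = σ := by
  rcases K.eq_empty_or_nonempty with rfl | hne
  · have : σ = 0 := by simpa using hσ
    exact ⟨0, by simp [this]⟩
  obtain ⟨s, hs, hsec⟩ := hK.exists_measurable_section hne hg
  refine ⟨σ.map s, ?_, ?_⟩
  · rw [Measure.map_apply hs hK.measurableSet.compl]
    exact measure_mono_null (fun y hy hyK => hy (hsec y hyK).1) hσ
  · rw [Measure.map_map hg.measurable hs]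
    have : g ∘ s =ᵐ[σ] id := by
      have hae : ∀ᵐ y ∂σ, y ∈ g '' K := hσ
      filter_upwards [hae] with y hy using (hsec y hy).2
    rw [Measure.map_congr this, Measure.map_id]

/-- Haar measure on a nontrivial space takes all intermediate values on subsets of a bounded set. -/
lemma exists_measurableSet_subset_measure_eq {E : Type*} [NormedAddCommGroup E]
    [NormedSpace ℝ E] [FiniteDimensional ℝ E] [Nontrivial E] [MeasurableSpace E] [BorelSpace E]
    (μ : Measure E) [μ.IsAddHaarMeasure] {D : Set E} (hD : MeasurableSet D)
    (hb : Bornology.IsBounded D) {r : ℝ≥0∞} (hr : r ≤ μ D) :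
    ∃ B ⊆ D, MeasurableSet B ∧ μ B = r := by
  obtain ⟨R, hR⟩ := hb.subset_closedBall 0
  have hcont : Continuous fun ρ : ℝ => μ (D ∩ Metric.closedBall 0 ρ) := by
    rw [continuous_iff_continuousAt]
    intro ρ
    refine tendsto_measure_of_ae_tendsto_indicator _
      (hD.inter Metric.isClosed_closedBall.measurableSet)
      (fun i => hD.inter Metric.isClosed_closedBall.measurableSet) hD
      hb.measure_lt_top.ne (.of_forall fun i => Set.inter_subset_left) ?_
    have hae : ∀ᵐ x ∂μ, x ∉ Metric.sphere (0 : E) ρ :=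
      measure_eq_zero_iff_ae_notMem.mp (Measure.addHaar_sphere μ 0 ρ)
    filter_upwards [hae] with x hx
    simp only [Set.mem_inter_iff, mem_closedBall_zero_iff]
    rcases lt_or_gt_of_ne (show ‖x‖ ≠ ρ by simpa using hx) with h | h
    · filter_upwards [lt_mem_nhds h] with i hi
      simp [h.le, hi.le]
    · filter_upwards [gt_mem_nhds h] with i hi
      simp [not_le.mpr h, not_le.mpr hi]
  have hmem : r ∈ Set.Icc (μ (D ∩ Metric.closedBall 0 (-1)))
      (μ (D ∩ Metric.closedBall 0 (max R (-1)))) := by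
    rw [Set.inter_eq_left.mpr (hR.trans (Metric.closedBall_subset_closedBall (le_max_left _ _))),
      Metric.closedBall_eq_empty.mpr (by norm_num)]
    simpa using hr
  obtain ⟨ρ, -, hρ⟩ := intermediate_value_Icc (le_max_right R (-1)) hcont.continuousOn hmem
  exact ⟨_, Set.inter_subset_left, hD.inter Metric.isClosed_closedBall.measurableSet, hρ⟩

/-- The occupation measure up to time `t` balances the final and initial distributions. -/
lemma map_iterate_add_sum {E : Type*} [MeasurableSpace E] {f : E → E} (hf : Measurable f)
    (m : Measure E) (t : ℕ) :
    m.map f^[t] + ∑ j ∈ Finset.range t, m.map f^[j] =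
      (∑ j ∈ Finset.range t, m.map f^[j]).map f + m := by
  induction t with
  | zero => simp
  | succ t ih =>
    rw [Finset.sum_range_succ, Measure.map_add _ _ hf, Measure.map_map hf (hf.iterate t),
      ← Function.iterate_succ', add_right_comm, ← ih]
    abel

namespace PrimalFeasible

variable {n T : ℕ} {f : (Fin n → ℝ) → (Fin n → ℝ)} {X0 X : Set (Fin n → ℝ)}
  {μ₀ μ μh ν : Measure (Fin n → ℝ)} {a : ℝ≥0∞}

lemma measure_le_volume (h : PrimalFeasible n f X0 X T μ₀ μ μh ν a) : μ ≤ volume := by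
  obtain ⟨-, -, -, -, -, -, -, -, -, -, hle⟩ := h
  exact (hle ▸ Measure.le_add_right le_rfl : μ ≤ volume.restrict X).trans Measure.restrict_le_self

lemma measure_univ_le (h : PrimalFeasible n f X0 X T μ₀ μ μh ν a) :
    ν Set.univ ≤ T * volume X := by
  obtain ⟨-, -, -, -, -, -, -, -, hmass, -, -⟩ := h
  exact hmass ▸ le_self_add

lemma measure_add_measure_le (h : PrimalFeasible n f X0 X T μ₀ μ μh ν a) (hf : Measurable f)
    {A B : Set (Fin n → ℝ)} (hA : MeasurableSet A) (hAX0 : A ⊆ X0ᶜ) (hAB : f ⁻¹' A ⊆ B) :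
    μ A + ν A ≤ ν B := by
  obtain ⟨-, -, -, -, hμ₀, -, -, -, -, hflow, -⟩ := h
  have := congrArg (fun τ : Measure (Fin n → ℝ) => τ A) hflow
  simp only [Measure.add_apply, Measure.map_apply hf hA, measure_mono_null hAX0 hμ₀,
    add_zero] at this
  exact this.trans_le (measure_mono hAB)

lemma measure_compl_eq_zero (h : PrimalFeasible n f X0 X T μ₀ μ μh ν a) (hf : Measurable f)
    {R : Set (Fin n → ℝ)} (hR : MeasurableSet R) (hX0 : X0 ⊆ R) (hfR : Set.MapsTo f R R) :
    μ Rᶜ = 0 := by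
  have := h.2.2.2.1
  have hle : μ Rᶜ + ν Rᶜ ≤ 0 + ν Rᶜ := by
    rw [zero_add]
    exact h.measure_add_measure_le hf hR.compl (Set.compl_subset_compl.mpr hX0)
      fun x hx hxR => hx (hfR hxR)
  exact le_zero_iff.mp ((ENNReal.add_le_add_iff_right (measure_ne_top ν _)).mp hle)

lemma sum_measure_compl_le (h : PrimalFeasible n f X0 X T μ₀ μ μh ν a) (hf : Measurable f)
    {P : ℕ → Set (Fin n → ℝ)} (hP : ∀ j, MeasurableSet (P j)) (hX0 : ∀ j, X0 ⊆ P j)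
    (hfP : ∀ j, Set.MapsTo f (P j) (P (j + 1))) (K : ℕ) :
    ∑ j ∈ Finset.range K, μ (P j)ᶜ ≤ T * volume X := by
  have key : ∀ K, ∑ j ∈ Finset.range (K + 1), μ (P j)ᶜ + ν (P K)ᶜ ≤ ν Set.univ := by
    intro K
    induction K with
    | zero =>
      simpa using h.measure_add_measure_le hf (hP 0).compl
        (Set.compl_subset_compl.mpr (hX0 0)) (Set.subset_univ _)
    | succ K ih =>
      rw [Finset.sum_range_succ, add_assoc]
      refine le_trans ?_ ih
      gcongr
      exact h.measure_add_measure_le hf (hP _).compl (Set.compl_subset_compl.mpr (hX0 _))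
        fun x hx hxP => hx (hfP K hxP)
  refine le_trans ?_ h.measure_univ_le
  refine le_trans ?_ (key K)
  rw [Finset.sum_range_succ, add_assoc]
  exact le_self_add

lemma mul_measure_univ_le (h : PrimalFeasible n f X0 X T μ₀ μ μh ν a) (hf : Measurable f)
    {P : ℕ → Set (Fin n → ℝ)} (hP : ∀ j, MeasurableSet (P j)) (hX0 : ∀ j, X0 ⊆ P j)
    (hfP : ∀ j, Set.MapsTo f (P j) (P (j + 1))) (K : ℕ) :
    K * μ Set.univ ≤ ∑ j ∈ Finset.range K, volume (P j) + T * volume X := by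
  calc K * μ Set.univ = ∑ j ∈ Finset.range K, (μ (P j) + μ (P j)ᶜ) := by
        simp [measure_add_measure_compl (hP _)]
    _ ≤ _ := by
        rw [Finset.sum_add_distrib]
        gcongr
        · exact h.measure_le_volume
        · exact h.sum_measure_compl_le hf hP hX0 hfP K

/-- Lebesgue measure on a disjoint union of pieces of the images `f^t(X⁰)` is feasible as soon
as the total transport time of the pieces is within budget. -/
lemma exists_restrict_iUnion (hf : Continuous f) (hX0 : IsCompact X0) (hX : IsCompact X)
    (hreach : (⋃ t : ℕ, f^[t] '' X0) ⊆ X) {S : ℕ → Set (Fin n → ℝ)}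
    (hS : ∀ t, MeasurableSet (S t)) (hd : Pairwise (Function.onFun Disjoint S))
    (hsub : ∀ t, S t ⊆ f^[t] '' X0) (hcost : ∑' t : ℕ, (t : ℝ≥0∞) * volume (S t) ≤ T * volume X) :
    ∃ μ₀ μh ν a, PrimalFeasible n f X0 X T μ₀ (volume.restrict (⋃ t, S t)) μh ν a := by
  have hfm := hf.measurable
  have hσ : ∀ t, volume.restrict (S t) (f^[t] '' X0)ᶜ = 0 := fun t => by
    rw [Measure.restrict_apply (hX0.image (hf.iterate t)).measurableSet.compl,
      Set.disjoint_iff_inter_eq_empty.mp (Set.disjoint_compl_left_iff_subset.mpr (hsub t)),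
      measure_empty]
  choose m hm hmap using fun t => hX0.exists_map_eq (hf.iterate t) (hσ t)
  have hmass : ∀ t, m t Set.univ = volume (S t) := fun t => by
    have := congrArg (fun τ : Measure (Fin n → ℝ) => τ Set.univ) (hmap t)
    simpa [Measure.map_apply (hfm.iterate t) MeasurableSet.univ] using this
  have hSX : (⋃ t, S t) ⊆ X := (Set.iUnion_mono hsub).trans hreach
  have hSmeas : MeasurableSet (⋃ t, S t) := .iUnion hS
  have hvol : volume (⋃ t, S t) = ∑' t, volume (S t) := measure_iUnion hd hS
  set N : ℕ → Measure (Fin n → ℝ) := fun t => ∑ j ∈ Finset.range t, (m t).map f^[j] with hN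
  have hNmass : ∀ t, N t Set.univ = t * volume (S t) := fun t => by
    simp [hN, Measure.map_apply (hfm.iterate _) MeasurableSet.univ, hmass]
  have hνmass : Measure.sum N Set.univ ≤ T * volume X := by
    simpa [Measure.sum_apply _ MeasurableSet.univ, hNmass] using hcost
  have hNX : ∀ t, N t Xᶜ = 0 := fun t => by
    simp only [hN, Measure.coe_finsetSum, Finset.sum_apply, Finset.sum_eq_zero_iff]
    intro j _
    rw [Measure.map_apply (hfm.iterate j) hX.measurableSet.compl]
    have hmaps : X0 ⊆ f^[j] ⁻¹' X := fun x hx0 => hreach (Set.mem_iUnion.mpr ⟨j, x, hx0, rfl⟩)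
    exact measure_mono_null (Set.compl_subset_compl.mpr hmaps) (hm t)
  refine ⟨Measure.sum m, volume.restrict (X \ ⋃ t, S t), Measure.sum N,
    T * volume X - Measure.sum N Set.univ, ⟨?_⟩, ⟨?_⟩, ⟨?_⟩, ⟨?_⟩, ?_, ?_, ?_, ?_, ?_, ?_, ?_⟩
  · rw [Measure.sum_apply _ MeasurableSet.univ]
    simp only [hmass, ← hvol]
    exact (measure_mono hSX).trans_lt hX.measure_lt_top
  · rw [Measure.restrict_apply_univ]
    exact (measure_mono hSX).trans_lt hX.measure_lt_top
  · rw [Measure.restrict_apply_univ]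
    exact (measure_mono Set.sdiff_subset).trans_lt hX.measure_lt_top
  · exact hνmass.trans_lt (ENNReal.mul_lt_top (ENNReal.natCast_lt_top T) hX.measure_lt_top)
  · rw [Measure.sum_apply _ hX0.measurableSet.compl]
    simp [hm]
  · rw [Measure.restrict_apply hX.measurableSet.compl]
    exact measure_mono_null (fun x hx => hx.1 (hSX hx.2)) measure_empty
  · rw [Measure.restrict_apply hX.measurableSet.compl]
    exact measure_mono_null (fun x hx => hx.1 hx.2.1) measure_empty
  · rw [Measure.sum_apply _ hX.measurableSet.compl]
    simp [hNX]
  · exact add_tsub_cancel_of_le hνmass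
  · rw [Measure.restrict_iUnion hd hS, Measure.sum_add_sum, Measure.map_sum hfm.aemeasurable,
      Measure.sum_add_sum]
    congr 1
    funext t
    rw [← hmap t]
    exact map_iterate_add_sum hfm (m t) t
  · rw [← Measure.restrict_union Set.disjoint_sdiff_right (hX.measurableSet.diff hSmeas),
      Set.union_sdiff_cancel hSX]

end PrimalFeasible

lemma sum_sum_range_succ_add_sum_mul (d : ℕ → ℝ≥0∞) (K : ℕ) :
    ∑ j ∈ Finset.range K, ∑ t ∈ Finset.range (j + 1), d t + ∑ t ∈ Finset.range K, t * d t =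
      K * ∑ t ∈ Finset.range K, d t := by
  induction K with
  | zero => simp
  | succ K ih =>
    rw [Finset.sum_range_succ, Finset.sum_range_succ (fun t : ℕ => (t : ℝ≥0∞) * d t),
      add_add_add_comm, ih, Finset.sum_range_succ d K]
    push_cast
    ring

/-- The disjoint pieces of an optimal set: either the whole reachable set is affordable, or the
budget is exhausted by the points of smallest hitting time. -/
lemma exists_optimal_pieces {n : ℕ} (hn : 1 ≤ n) {f : (Fin n → ℝ) → (Fin n → ℝ)}
    (hf : Continuous f) {X0 X : Set (Fin n → ℝ)} (hX0 : IsCompact X0) (hX : IsCompact X)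
    (hreach : (⋃ t : ℕ, f^[t] '' X0) ⊆ X) (T : ℕ) :
    ∃ S : ℕ → Set (Fin n → ℝ), (∀ t, MeasurableSet (S t)) ∧
      Pairwise (Function.onFun Disjoint S) ∧ (∀ t, S t ⊆ f^[t] '' X0) ∧
      ∑' t : ℕ, (t : ℝ≥0∞) * volume (S t) ≤ T * volume X ∧
      (⋃ t ∈ Finset.range (T + 1), f^[t] '' X0) ⊆ ⋃ t, S t ∧
      ∀ μ₀ μ μh ν a, PrimalFeasible n f X0 X T μ₀ μ μh ν a →
        μ Set.univ ≤ volume (⋃ t, S t) := by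
  have hfm := hf.measurable
  have : Nonempty (Fin n) := ⟨⟨0, hn⟩⟩
  set I : ℕ → Set (Fin n → ℝ) := fun t => f^[t] '' X0 with hI
  set D := disjointed I with hD
  set P : ℕ → Set (Fin n → ℝ) := fun j => ⋃ t ∈ Finset.range (j + 1), I t with hPdef
  set C := (T : ℝ≥0∞) * volume X with hC
  have hIm : ∀ t, MeasurableSet (I t) := fun t => (hX0.image (hf.iterate t)).measurableSet
  have hDm : ∀ t, MeasurableSet (D t) := MeasurableSet.disjointed hIm
  have hDI : ∀ t, D t ⊆ I t := disjointed_subset I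
  have hDd : Pairwise (Function.onFun Disjoint D) := disjoint_disjointed I
  have hUD : ⋃ t, D t = ⋃ t, I t := iUnion_disjointed
  have hDP : ∀ j, ⋃ t ∈ Finset.range (j + 1), D t = P j := fun j => by
    rw [hD, biUnion_range_succ_disjointed, partialSups_eq_biSup]
    ext x
    simp [hPdef]
  have hPvol : ∀ j, volume (P j) = ∑ t ∈ Finset.range (j + 1), volume (D t) := fun j => by
    rw [← hDP, measure_biUnion_finset (fun s _ t _ hst => hDd hst) fun t _ => hDm t]
  have hPm : ∀ j, MeasurableSet (P j) := fun j => Finset.measurableSet_biUnion _ fun t _ => hIm t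
  have hIf : ∀ {t x}, x ∈ I t → f x ∈ I (t + 1) := by
    rintro t _ ⟨x, hx, rfl⟩
    exact ⟨x, hx, Function.iterate_succ_apply' f t x⟩
  have hfP : ∀ j, Set.MapsTo f (P j) (P (j + 1)) := by
    intro j x hx
    simp only [hPdef, Set.mem_iUnion, Finset.mem_range] at hx ⊢
    obtain ⟨t, ht, hxt⟩ := hx
    exact ⟨t + 1, by lia, hIf hxt⟩
  have hX0I : X0 = I 0 := by simp [hI]
  have hX0P : ∀ j, X0 ⊆ P j := fun j => hX0I ▸
    Set.subset_biUnion_of_mem (u := I) (Finset.mem_coe.mpr (Finset.mem_range.mpr j.succ_pos))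
  have hPX : ∀ j, P j ⊆ X := fun j => (Set.iUnion₂_subset_iUnion _ _).trans hreach
  by_cases hafford : ∀ K, ∑ t ∈ Finset.range K, (t : ℝ≥0∞) * volume (D t) ≤ C
  · refine ⟨D, hDm, hDd, hDI, ENNReal.tsum_le_of_sum_range_le hafford, ?_, ?_⟩
    · rw [hUD]
      exact Set.iUnion₂_subset_iUnion _ _
    · intro μ₀ μ μh ν a h
      have hR : MeasurableSet (⋃ t, I t) := .iUnion hIm
      rw [hUD, ← measure_add_measure_compl hR, h.measure_compl_eq_zero hfm hR
        (hX0I ▸ Set.subset_iUnion I 0), add_zero]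
      · exact h.measure_le_volume _
      · intro x hx
        obtain ⟨t, ht⟩ := Set.mem_iUnion.mp hx
        exact Set.mem_iUnion.mpr ⟨t + 1, hIf ht⟩
  · classical
    push Not at hafford
    obtain ⟨K, hKC, hK⟩ : ∃ K, ∑ t ∈ Finset.range K, (t : ℝ≥0∞) * volume (D t) ≤ C ∧
        C < ∑ t ∈ Finset.range (K + 1), (t : ℝ≥0∞) * volume (D t) := by
      have hfind := Nat.find_spec hafford
      have hmin := fun {m} => Nat.find_min hafford (m := m)
      obtain ⟨K, hK⟩ : ∃ K, Nat.find hafford = K + 1 := by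
        refine Nat.exists_eq_succ_of_ne_zero fun h0 => ?_
        simp [h0] at hfind
      exact ⟨K, not_lt.mp (hmin (by lia)), hK ▸ hfind⟩
    have hTK : T < K := by
      by_contra! hle
      refine hK.not_ge ?_
      calc ∑ t ∈ Finset.range (K + 1), (t : ℝ≥0∞) * volume (D t)
          ≤ ∑ t ∈ Finset.range (K + 1), (T : ℝ≥0∞) * volume (D t) := by
            gcongr with t ht
            have := Finset.mem_range.mp ht
            lia
        _ = T * volume (P K) := by rw [← Finset.mul_sum, hPvol]
        _ ≤ C := by rw [hC]; gcongr; exact hPX K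
    have hK0 : (K : ℝ≥0∞) ≠ 0 := Nat.cast_ne_zero.mpr (by lia)
    have hKtop : (K : ℝ≥0∞) ≠ ⊤ := ENNReal.natCast_ne_top K
    set r := (C - ∑ t ∈ Finset.range K, (t : ℝ≥0∞) * volume (D t)) / K with hr
    have hKr : ∑ t ∈ Finset.range K, (t : ℝ≥0∞) * volume (D t) + K * r = C := by
      rw [hr, ENNReal.mul_div_cancel hK0 hKtop, add_tsub_cancel_of_le hKC]
    have hrD : r ≤ volume (D K) := by
      refine ENNReal.div_le_of_le_mul' (tsub_le_iff_left.mpr ?_)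
      rw [← Finset.sum_range_succ (fun t : ℕ => (t : ℝ≥0∞) * volume (D t))]
      exact hK.le
    obtain ⟨B, hBD, hBm, hB⟩ := exists_measurableSet_subset_measure_eq volume (hDm K)
      (hX.isBounded.subset ((hDI K).trans ((Set.subset_iUnion I K).trans hreach))) hrD
    set S : ℕ → Set (Fin n → ℝ) := fun t => if t < K then D t else if t = K then B else ∅ with hS
    have hSlt : ∀ {t}, t < K → S t = D t := fun ht => if_pos ht
    have hSK : S K = B := by simp [hS]
    have hSgt : ∀ {t}, K < t → S t = ∅ := fun ht => by
      simp [hS, ht.not_gt, ht.ne']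
    have hSD : ∀ t, S t ⊆ D t := fun t => by
      rcases lt_trichotomy t K with h | rfl | h
      · rw [hSlt h]
      · rwa [hSK]
      · simp [hSgt h]
    have hSm : ∀ t, MeasurableSet (S t) := fun t => by
      rcases lt_trichotomy t K with h | rfl | h
      · rw [hSlt h]; exact hDm t
      · rwa [hSK]
      · simp [hSgt h]
    have hSd : Pairwise (Function.onFun Disjoint S) :=
      fun s t hst => (hDd hst).mono (hSD s) (hSD t)
    have hsum : ∀ c : ℕ → ℝ≥0∞, ∑' t, c t * volume (S t) =
        ∑ t ∈ Finset.range K, c t * volume (D t) + c K * r := fun c => by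
      rw [tsum_eq_sum (s := Finset.range (K + 1)), Finset.sum_range_succ, hSK, hB]
      · congr 1
        exact Finset.sum_congr rfl fun t ht => by rw [hSlt (Finset.mem_range.mp ht)]
      · intro t ht
        rw [hSgt (by rw [Finset.mem_range] at ht; lia), measure_empty, mul_zero]
    refine ⟨S, hSm, hSd, fun t => (hSD t).trans (hDI t), ?_, ?_, ?_⟩
    · rw [hsum, hKr]
    · change P T ⊆ _
      rw [← hDP]
      refine Set.iUnion₂_subset fun t ht => ?_
      have := Finset.mem_range.mp ht
      rw [← hSlt (by lia : t < K)]
      exact Set.subset_iUnion S t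
    · intro μ₀ μ μh ν a h
      have hvol : volume (⋃ t, S t) = ∑ t ∈ Finset.range K, volume (D t) + r := by
        simpa [measure_iUnion hSd hSm] using hsum 1
      have hmul := h.mul_measure_univ_le hfm hPm hX0P hfP K
      rw [← hC, ← hKr, ← add_assoc] at hmul
      simp only [hPvol] at hmul
      rw [sum_sum_range_succ_add_sum_mul, ← mul_add, ← hvol] at hmul
      exact (ENNReal.mul_le_mul_iff_right hK0 hKtop).mp hmul

/-- The primal LP admits an optimal solution whose `μ`-component is the restriction of
the Lebesgue measure to some Borel set `S^T` with `X^T ⊆ S^T ⊆ cl(X^∞)` and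
`vol S^T = p^T`. -/
theorem primal_attained (n : ℕ) (hn : 1 ≤ n)
    (f : (Fin n → ℝ) → (Fin n → ℝ))
    (hfpoly : ∀ i, ∃ p : MvPolynomial (Fin n) ℝ, ∀ x, f x i = MvPolynomial.eval x p)
    (X0 X : Set (Fin n → ℝ)) (hX0 : IsCompact X0) (hX : IsCompact X)
    (hreach : (⋃ t : ℕ, f^[t] '' X0) ⊆ X)
    (T : ℕ) (hT : 1 ≤ T) :
    ∃ μ₀ μ μh ν a, PrimalFeasible n f X0 X T μ₀ μ μh ν a ∧
      μ Set.univ = primalValue n f X0 X T ∧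
      ∃ S : Set (Fin n → ℝ), MeasurableSet S ∧
        (⋃ t ∈ Finset.range (T + 1), f^[t] '' X0) ⊆ S ∧
        S ⊆ closure (⋃ t : ℕ, f^[t] '' X0) ∧
        μ = volume.restrict S ∧
        volume S = primalValue n f X0 X T := by
  have hf : Continuous f := continuous_pi fun i => by
    obtain ⟨p, hp⟩ := hfpoly i
    simpa only [hp] using MvPolynomial.continuous_eval p
  obtain ⟨S, hSm, hSd, hSI, hcost, hTS, hopt⟩ := exists_optimal_pieces hn hf hX0 hX hreach T
  obtain ⟨μ₀, μh, ν, a, h⟩ :=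
    PrimalFeasible.exists_restrict_iUnion hf hX0 hX hreach hSm hSd hSI hcost
  have hvalue : volume (⋃ t, S t) = primalValue n f X0 X T := by
    refine le_antisymm (le_sSup ⟨μ₀, _, μh, ν, a, h, Measure.restrict_apply_univ _ |>.symm⟩)
      (sSup_le ?_)
    rintro _ ⟨μ₀, μ, μh, ν, a, h, rfl⟩
    exact hopt _ _ _ _ _ h
  exact ⟨μ₀, _, μh, ν, a, h, (Measure.restrict_apply_univ _).trans hvalue, ⋃ t, S t,
    .iUnion hSm, hTS, (Set.iUnion_mono hSI).trans subset_closure, rfl, hvalue⟩
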